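/- Let ρ be a growth function, let m ≥ 1 and 0 ≤ k ≤ m be integers, and let σ ∈ {−1,1}^m satisfy |σ| = k. Define θ = (θ_1,…,θ_m) ∈ {−1,1}^m by θ_i = 1 for 1 ≤ i ≤ k and θ_i = −1 for k+1 ≤ i ≤ m. Writing f_σ^ρ = (a_σ, b_σ) and f_θ^ρ = (a_θ, b_θ), one has a_σ ≤ a_θ and b_σ = b_θ. -/

import Mathlib

open scoped BigOperators symmDiff
open Finset

attribute [local instance] Classical.propDecidable

namespace PaperTS

noncomputable section

/-- The group `𝔽_p^n`, written additively. -/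
abbrev Vec (p n : ℕ) := Fin n → ZMod p

/-- Dot product on `𝔽_p^n`. -/
def dot {p n : ℕ} (x y : Vec p n) : ZMod p := ∑ i, x i * y i

/-- A quadratic factor of complexity `(ℓ, q)` on `𝔽_p^n`: a set of `ℓ` linearly independent
vectors together with a set of `q` pairwise distinct symmetric matrices. -/
structure QuadFactor (p n ℓ q : ℕ) where
  L : Fin ℓ → Vec p n
  Q : Fin q → Matrix (Fin n) (Fin n) (ZMod p)
  linIndep : LinearIndependent (ZMod p) L
  symm : ∀ j, (Q j).IsSymm
  inj : Function.Injective Q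

/-- Labels of atoms of a quadratic factor of complexity `(ℓ, q)`. -/
abbrev Label (p ℓ q : ℕ) := (Fin ℓ → ZMod p) × (Fin q → ZMod p)

namespace QuadFactor

variable {p n ℓ q : ℕ}

/-- The linear form `β_L`. -/
def betaL (B : QuadFactor p n ℓ q) (x : Vec p n) : Fin ℓ → ZMod p :=
  fun i => dot x (B.L i)

/-- The bilinear form `β_Q`. -/
def betaQ (B : QuadFactor p n ℓ q) (x y : Vec p n) : Fin q → ZMod p :=
  fun j => dot x ((B.Q j).mulVec y)

/-- The labelling map `β_𝓑`. -/
def betaB (B : QuadFactor p n ℓ q) (x : Vec p n) : Label p ℓ q :=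
  (B.betaL x, B.betaQ x x)

/-- The atom of `B` with label `ab`. -/
def atom (B : QuadFactor p n ℓ q) (ab : Label p ℓ q) : Set (Vec p n) :=
  {x | B.betaB x = ab}

/-- The fibre `β_Q^{-1}(d) ⊆ G × G`. -/
def fibQ (B : QuadFactor p n ℓ q) (d : Fin q → ZMod p) : Set (Vec p n × Vec p n) :=
  {xy | B.betaQ xy.1 xy.2 = d}

/-- The rank of a quadratic factor: `n` if `q = 0`, and otherwise the minimal rank of a
nontrivial linear combination of the matrices. -/
def rank (B : QuadFactor p n ℓ q) : ℕ :=
  if q = 0 then n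
  else sInf ((fun c : Fin q → ZMod p => (∑ j, c j • B.Q j).rank) '' {c | c ≠ 0})

end QuadFactor

/-- Refinement of quadratic factors: every atom of `B'` is contained in an atom of `B`. -/
def Refines {p n ℓ' q' ℓ q : ℕ} (B' : QuadFactor p n ℓ' q') (B : QuadFactor p n ℓ q) : Prop :=
  ∀ ab' : Label p ℓ' q', ∃ ab : Label p ℓ q, B'.atom ab' ⊆ B.atom ab

/-- `Σ(d)` for a tuple of labels `d = (d_a, d_b, d_c, d_ab, d_ac, d_bc)`. -/
def SigmaD {p ℓ q : ℕ} (da db dc : Label p ℓ q) (dab dac dbc : Fin q → ZMod p) :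
    Label p ℓ q :=
  (da.1 + db.1 + dc.1, da.2 + db.2 + dc.2 + 2 • dab + 2 • dac + 2 • dbc)

/-- Real-valued indicator function of a set. -/
def ind1 {G : Type*} (S : Set G) : G → ℝ := S.indicator 1

/-- Density of `A` on `P`. -/
def density {G : Type*} (A P : Set G) : ℝ := ((A ∩ P).ncard : ℝ) / (P.ncard : ℝ)

/-- Sum of `g` over a set in a fintype. -/
def setSum {α : Type*} [Fintype α] (s : Set α) (g : α → ℝ) : ℝ :=
  ∑ x ∈ Finset.univ.filter (fun x => x ∈ s), g x

/-- Average of `g` over a set in a fintype. -/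
def expOver {α : Type*} [Fintype α] (s : Set α) (g : α → ℝ) : ℝ :=
  setSum s g / (s.ncard : ℝ)

/-- The normalized indicator `μ_Γ` of `Γ ⊆ G × G`. -/
def mu {G : Type*} [Fintype G] (Γ : Set (G × G)) (xy : G × G) : ℝ :=
  ((Fintype.card G : ℝ) ^ 2 / (Γ.ncard : ℝ)) * ind1 Γ xy

/-- The product of the 8 values of `f` on the cube generated by `x, h₁, h₂, h₃`. -/
def cubeProd {G : Type*} [AddCommGroup G] (f : G → ℝ) (x h₁ h₂ h₃ : G) : ℝ :=
  f x * f (x + h₁) * f (x + h₂) * f (x + h₃) * f (x + h₁ + h₂) * f (x + h₁ + h₃) *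
    f (x + h₂ + h₃) * f (x + h₁ + h₂ + h₃)

/-- The eighth power of the (unnormalized) `U³` norm. -/
def U3pow8 {G : Type*} [AddCommGroup G] [Fintype G] (f : G → ℝ) : ℝ :=
  ∑ x : G, ∑ h₁ : G, ∑ h₂ : G, ∑ h₃ : G, cubeProd f x h₁ h₂ h₃

/-- The (unnormalized) `U³` norm. -/
def U3norm {G : Type*} [AddCommGroup G] [Fintype G] (f : G → ℝ) : ℝ :=
  U3pow8 f ^ ((1 : ℝ) / 8)

/-- The Prendiville local `U³` norm of `f` relative to the set `B`
(equal to `0` when `‖1_B‖_{U³} = 0`, by the division-by-zero convention). -/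
def U3localP {G : Type*} [AddCommGroup G] [Fintype G] (f : G → ℝ) (B : Set G) : ℝ :=
  U3norm (fun x => f x * ind1 B x) / U3norm (ind1 B)

/-- `Ω_B`: the 4-tuples all of whose associated cube points lie in `B`. -/
def Omega {G : Type*} [AddCommGroup G] (B : Set G) : Set (G × G × G × G) :=
  fun t =>
    match t with
    | (x, h₁, h₂, h₃) =>
        x ∈ B ∧ x + h₁ ∈ B ∧ x + h₂ ∈ B ∧ x + h₃ ∈ B ∧
        x + h₁ + h₂ ∈ B ∧ x + h₁ + h₃ ∈ B ∧ x + h₂ + h₃ ∈ B ∧ x + h₁ + h₂ + h₃ ∈ B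

/-- The change of variables `Ψ : G⁶ → G⁴`. -/
def Psi {G : Type*} [AddCommGroup G] : G × G × G × G × G × G → G × G × G × G :=
  fun t =>
    match t with
    | (x₁, x₂, y₁, y₂, z₁, z₂) => (x₁ + y₁ + z₁, x₂ - x₁, y₂ - y₁, z₂ - z₁)

/-- `K_{2,2,2}(d)`. -/
def K222 {p n ℓ q : ℕ} (B : QuadFactor p n ℓ q) (da db dc : Label p ℓ q)
    (dab dac dbc : Fin q → ZMod p) :
    Set (Vec p n × Vec p n × Vec p n × Vec p n × Vec p n × Vec p n) :=
  fun t =>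
    match t with
    | (x₁, x₂, y₁, y₂, z₁, z₂) =>
        B.betaB x₁ = da ∧ B.betaB x₂ = da ∧ B.betaB y₁ = db ∧ B.betaB y₂ = db ∧
        B.betaB z₁ = dc ∧ B.betaB z₂ = dc ∧
        B.betaQ x₁ y₁ = dab ∧ B.betaQ x₁ y₂ = dab ∧ B.betaQ x₂ y₁ = dab ∧ B.betaQ x₂ y₂ = dab ∧
        B.betaQ x₁ z₁ = dac ∧ B.betaQ x₁ z₂ = dac ∧ B.betaQ x₂ z₁ = dac ∧ B.betaQ x₂ z₂ = dac ∧
        B.betaQ y₁ z₁ = dbc ∧ B.betaQ y₁ z₂ = dbc ∧ B.betaQ y₂ z₁ = dbc ∧ B.betaQ y₂ z₂ = dbc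

/-- The product `∏_{i,j,k ∈ {1,2}} f (x_i + y_j + z_k)` for a 6-tuple. -/
def prod8 {G : Type*} [AddCommGroup G] (f : G → ℝ) :
    G × G × G × G × G × G → ℝ :=
  fun t =>
    match t with
    | (x₁, x₂, y₁, y₂, z₁, z₂) =>
        f (x₁ + y₁ + z₁) * f (x₁ + y₁ + z₂) * f (x₁ + y₂ + z₁) * f (x₁ + y₂ + z₂) *
        f (x₂ + y₁ + z₁) * f (x₂ + y₁ + z₂) * f (x₂ + y₂ + z₁) * f (x₂ + y₂ + z₂)

/-- The eighth power of the Terry–Wolf local `U³` norm. -/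
def TW8 {p n ℓ q : ℕ} [NeZero p] (B : QuadFactor p n ℓ q) (f : Vec p n → ℝ)
    (da db dc : Label p ℓ q) (dab dac dbc : Fin q → ZMod p) : ℝ :=
  expOver (B.atom da) fun x₀ => expOver (B.atom da) fun x₁ =>
  expOver (B.atom db) fun y₀ => expOver (B.atom db) fun y₁ =>
  expOver (B.atom dc) fun z₀ => expOver (B.atom dc) fun z₁ =>
    (mu (B.fibQ dab) (x₀, y₀) * mu (B.fibQ dab) (x₀, y₁) *
     mu (B.fibQ dab) (x₁, y₀) * mu (B.fibQ dab) (x₁, y₁) *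
     mu (B.fibQ dac) (x₀, z₀) * mu (B.fibQ dac) (x₀, z₁) *
     mu (B.fibQ dac) (x₁, z₀) * mu (B.fibQ dac) (x₁, z₁) *
     mu (B.fibQ dbc) (y₀, z₀) * mu (B.fibQ dbc) (y₀, z₁) *
     mu (B.fibQ dbc) (y₁, z₀) * mu (B.fibQ dbc) (y₁, z₁)) *
    prod8 f (x₀, x₁, y₀, y₁, z₀, z₁)

/-- `A` has VC₂-dimension at least `k`. -/
def HasVC2Dim {G : Type*} [AddCommGroup G] (A : Set G) (k : ℕ) : Prop :=
  ∃ (a b : Fin k → G) (c : Set (Fin k × Fin k) → G),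
    ∀ (i j : Fin k) (S : Set (Fin k × Fin k)), (a i + b j + c S ∈ A ↔ (i, j) ∈ S)

/-- `A` has VC₂-dimension at most `k`. -/
def VC2dimLE {G : Type*} [AddCommGroup G] (A : Set G) (k : ℕ) : Prop :=
  ∀ m : ℕ, HasVC2Dim A m → m ≤ k

/-- A growth function: an increasing function `ℝ → ℝ≥0`. -/
def GrowthFunction (ρ : ℝ → ℝ) : Prop :=
  Monotone ρ ∧ ∀ x, 0 ≤ ρ x

/-- `ρ` is bounded by a polynomial of degree `d` on `[1, ∞)`. -/
def PolyBound (ρ : ℝ → ℝ) (d : ℕ) : Prop :=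
  ∃ C > (0 : ℝ), ∀ x : ℝ, 1 ≤ x → ρ x ≤ C * x ^ d

/-- `ρ` is a polynomial growth function of degree (exactly) `d`, i.e. `d ≥ 1` is minimal
with `ρ(x) ≤ C x^d` for `x ≥ 1`. -/
def PolyGrowthDegree (ρ : ℝ → ℝ) (d : ℕ) : Prop :=
  1 ≤ d ∧ PolyBound ρ d ∧ ∀ d' : ℕ, 1 ≤ d' → PolyBound ρ d' → d ≤ d'

/-- The index `ind(A, 𝒫)` of a partition. -/
def indx {p n : ℕ} (A : Set (Vec p n)) (Ps : Finset (Set (Vec p n))) : ℝ :=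
  (∑ P ∈ Ps, density A P ^ 2 * (P.ncard : ℝ)) / (p : ℝ) ^ n

/-- `P` fails to be `δ`-uniform for `A` with respect to the localized `U³` norm. -/
def BadPart {G : Type*} [AddCommGroup G] [Fintype G] (δ : ℝ) (A P : Set G) : Prop :=
  δ * U3norm (ind1 P) < U3norm (fun x => (ind1 A x - density A P) * ind1 P x)

/-- `ker(U)^⊥`, the orthogonal complement of the kernel of `U`. -/
def kerPerp {p n : ℕ} (U : Matrix (Fin n) (Fin n) (ZMod p)) : Set (Vec p n) :=
  {v | ∀ w : Vec p n, U.mulVec w = 0 → dot v w = 0}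

/-- `B'` is a `ρ`-matrix deletion of `B`. -/
def IsMatrixDeletion {p n ℓ' q' ℓ q : ℕ} (ρ : ℝ → ℝ)
    (B' : QuadFactor p n ℓ' q') (B : QuadFactor p n ℓ q) : Prop :=
  q' + 1 = q ∧
  ∃ c : Fin q → ZMod p, c ≠ 0 ∧
    (((∑ j, c j • B.Q j).rank : ℝ) < ρ ((ℓ : ℝ) + (q : ℝ))) ∧
    (∃ i : Fin q, c i ≠ 0 ∧ Set.range B'.Q = Set.range B.Q \ {B.Q i}) ∧
    Set.range B.L ⊆ Set.range B'.L ∧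
    Submodule.span (ZMod p) (Set.range B'.L) =
      Submodule.span (ZMod p) (Set.range B.L ∪ kerPerp (∑ j, c j • B.Q j))

/-- The functions `τ_i^ρ : ℤ × ℤ → ℝ`. -/
def tau (ρ : ℝ → ℝ) : ℕ → ℤ × ℤ → ℝ
  | 0, xy => (xy.1 : ℝ)
  | i + 1, xy => tau ρ i xy + ρ (tau ρ i xy + (xy.2 : ℝ) - (i : ℝ))

/-- `f_σ^ρ` for binary strings `σ : Fin m → ℤ` (with values in `{-1, 1}`). -/
def fseq (ρ : ℝ → ℝ) : (m : ℕ) → (Fin m → ℤ) → ℝ × ℝ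
  | 0, _ => (0, 0)
  | m + 1, σ =>
      let ab := fseq ρ m (fun j => σ j.castSucc)
      if σ (Fin.last m) = 1 then (ab.1 + 1, ab.2 + 1)
      else (ab.1 + ρ (ab.1 + ab.2), ab.2 - 1)

end

theorem tau_diag_add_one_le {ρ : ℝ → ℝ} (hρ : Monotone ρ) (k : ℤ) (n : ℕ) :
    tau ρ n (k, k) + 1 ≤ tau ρ n (k + 1, k + 1) := by
  induction n with
  | zero => simp [tau]
  | succ n ih =>
    have h : ρ (tau ρ n (k, k) + (k : ℝ) - n) ≤
        ρ (tau ρ n (k + 1, k + 1) + ((k + 1 : ℤ) : ℝ) - n) :=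
      hρ (by push_cast; linarith)
    simp only [tau]
    linarith

theorem card_filter_eq_one_succ {m : ℕ} (σ : Fin (m + 1) → ℤ) :
    (univ.filter fun j => σ j = 1).card =
      (univ.filter fun j : Fin m => σ j.castSucc = 1).card +
        if σ (Fin.last m) = 1 then 1 else 0 := by
  simp only [Finset.card_filter, Fin.sum_univ_castSucc]

theorem fseq_snd (ρ : ℝ → ℝ) (m : ℕ) (σ : Fin m → ℤ) :
    (fseq ρ m σ).2 = 2 * ((univ.filter fun j => σ j = 1).card : ℝ) - m := by
  induction m with
  | zero => simp [fseq]
  | succ m ih =>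
    rw [card_filter_eq_one_succ]
    by_cases h : σ (Fin.last m) = 1 <;> simp only [fseq, h, if_true, if_false, ih] <;>
      push_cast <;> ring

/-- Among the strings with `k` ones and `n` other entries, the first coordinate of `fseq` is at
most the value obtained by starting from `(k, k)` and appending `-1` exactly `n` times. -/
theorem fseq_fst_le_tau {ρ : ℝ → ℝ} (hρ : Monotone ρ) {m : ℕ} (σ : Fin m → ℤ) {k n : ℕ}
    (hk : (univ.filter fun j => σ j = 1).card = k) (hm : m = k + n) :
    (fseq ρ m σ).1 ≤ tau ρ n (k, k) := by
  induction m generalizing k n with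
  | zero =>
    obtain ⟨rfl, rfl⟩ : k = 0 ∧ n = 0 := by omega
    simp [fseq, tau]
  | succ m ih =>
    rw [card_filter_eq_one_succ] at hk
    have hcard := Finset.card_filter_le univ fun j : Fin m => σ j.castSucc = 1
    rw [Finset.card_fin] at hcard
    by_cases h : σ (Fin.last m) = 1
    · simp only [h, if_true] at hk
      subst hk
      have h₁ := ih (fun j => σ j.castSucc) rfl (n := n) (by omega)
      have h₂ := tau_diag_add_one_le hρ
        ((univ.filter fun j : Fin m => σ j.castSucc = 1).card : ℤ) n
      simp only [fseq, h, if_true]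
      push_cast
      linarith
    · simp only [h, if_false, add_zero] at hk
      obtain ⟨n, rfl⟩ : ∃ l, n = l + 1 := ⟨n - 1, by omega⟩
      have h₁ := ih (fun j => σ j.castSucc) hk (n := n) (by omega)
      have hb := fseq_snd ρ m fun j => σ j.castSucc
      have hm' : (m : ℝ) = k + n := by
        have : m = k + n := by omega
        exact_mod_cast this
      rw [hk, hm'] at hb
      have h₂ : ρ ((fseq ρ m fun j => σ j.castSucc).1 + (fseq ρ m fun j => σ j.castSucc).2) ≤
          ρ (tau ρ n (k, k) + ((k : ℤ) : ℝ) - n) :=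
        hρ (by push_cast; linarith)
      simp only [fseq, h, if_false, tau]
      linarith

theorem card_filter_initial_segment {m k : ℕ} (hk : k ≤ m) (θ : Fin m → ℤ)
    (hθ : ∀ j : Fin m, θ j = if (j : ℕ) < k then 1 else -1) :
    (univ.filter fun j => θ j = 1).card = k := by
  have h : ∀ j, θ j = 1 ↔ (j : ℕ) < k := fun j => by
    rw [hθ]
    split_ifs with hj <;> simp [hj]
  simp only [h]
  simpa [Fin.card_filter_val_lt] using hk

/-- The bound of `fseq_fst_le_tau` is attained when all ones come first. -/
theorem fseq_fst_eq_tau (ρ : ℝ → ℝ) {m : ℕ} (θ : Fin m → ℤ) {k n : ℕ} (hm : m = k + n)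
    (hθ : ∀ j : Fin m, θ j = if (j : ℕ) < k then 1 else -1) :
    (fseq ρ m θ).1 = tau ρ n (k, k) := by
  induction m generalizing k n with
  | zero =>
    obtain ⟨rfl, rfl⟩ : k = 0 ∧ n = 0 := by omega
    simp [fseq, tau]
  | succ m ih =>
    have hlast := hθ (Fin.last m)
    rw [Fin.val_last] at hlast
    cases n with
    | zero =>
      obtain rfl : k = m + 1 := by omega
      have h₁ := ih (fun j => θ j.castSucc) (k := m) (n := 0) (by omega) fun j => by
        rw [hθ, Fin.val_castSucc, if_pos j.isLt, if_pos (by omega)]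
      rw [if_pos (by omega)] at hlast
      simp only [fseq, hlast, if_true, h₁, tau]
      push_cast
      rfl
    | succ n =>
      have h₁ := ih (fun j => θ j.castSucc) (k := k) (n := n) (by omega) fun j => hθ j.castSucc
      have hb := fseq_snd ρ m fun j => θ j.castSucc
      rw [card_filter_initial_segment (k := k) (by omega) _ fun j => hθ j.castSucc] at hb
      rw [if_neg (by omega)] at hlast
      have hm' : (m : ℝ) = k + n := by
        have : m = k + n := by omega
        exact_mod_cast this
      have harg : tau ρ n (k, k) + (2 * (k : ℝ) - m) = tau ρ n (k, k) + ((k : ℤ) : ℝ) - n := by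
        push_cast
        linarith
      have hne : ¬ θ (Fin.last m) = 1 := by rw [hlast]; norm_num
      simp only [fseq, hne, if_false, h₁, hb, harg, tau]

theorem statement17 (ρ : ℝ → ℝ) (hρ : GrowthFunction ρ) (m : ℕ) (hm : 1 ≤ m)
    (k : ℕ) (hk : k ≤ m) (σ : Fin m → ℤ) (hσ : ∀ j, σ j = 1 ∨ σ j = -1)
    (hcount : (Finset.univ.filter fun j => σ j = 1).card = k)
    (θ : Fin m → ℤ) (hθ : ∀ j : Fin m, θ j = if (j : ℕ) < k then 1 else -1) :
    (fseq ρ m σ).1 ≤ (fseq ρ m θ).1 ∧ (fseq ρ m σ).2 = (fseq ρ m θ).2 := by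
  obtain ⟨n, rfl⟩ := Nat.exists_eq_add_of_le hk
  constructor
  · rw [fseq_fst_eq_tau ρ θ rfl hθ]
    exact fseq_fst_le_tau hρ.1 σ hcount rfl
  · rw [fseq_snd, fseq_snd, hcount, card_filter_initial_segment hk θ hθ]

end PaperTS
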